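/- arXiv:2106.02146 — 11 statements merged into one kernel-verified Lean document; each statement's English description precedes it below -/
import Mathlib

section
/- For a function F : EReal → EReal with monotone generalized inverse F†(y) = sInf {x : EReal | F x > y}, one has (F†)† = F if and only if F is monotone (non-decreasing), right-continuous at every point of EReal, and F(⊤) = ⊤. Equivalently, such F satisfy F(x) = sInf {t : EReal | F†(t) > x} for every x. -/
open Set

noncomputable def dagger (F : EReal → EReal) : EReal → EReal :=
  fun y => sInf {x : EReal | F x > y}

theorem dagger_monotone (G : EReal → EReal) : Monotone (dagger G) := by
  intro a b hab
  exact sInf_le_sInf fun x (hx : b < G x) => lt_of_le_of_lt hab hx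

theorem dagger_rightCont (G : EReal → EReal) (x : EReal) :
    ContinuousWithinAt (dagger G) (Set.Ioi x) x := by
  refine tendsto_order.2 ⟨fun a ha => ?_, fun a ha => ?_⟩
  · filter_upwards [self_mem_nhdsWithin] with y hy
    exact lt_of_lt_of_le ha (dagger_monotone G (le_of_lt hy))
  · obtain ⟨t, ht, hta⟩ := sInf_lt_iff.1 ha
    have ht' : x < G t := ht
    filter_upwards [mem_nhdsWithin_of_mem_nhds (Iio_mem_nhds ht')] with y hy
    exact lt_of_le_of_lt (sInf_le hy) hta

theorem dagger_top (G : EReal → EReal) : dagger G ⊤ = ⊤ := by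
  simp [dagger]

theorem dagger_dagger_eq_iff (F : EReal → EReal) :
    dagger (dagger F) = F ↔
      (Monotone F ∧ (∀ x : EReal, ContinuousWithinAt F (Set.Ioi x) x) ∧ F ⊤ = ⊤) := by
  constructor
  · intro h
    rw [← h]
    exact ⟨dagger_monotone _, dagger_rightCont _, dagger_top _⟩
  · rintro ⟨hm, hc, ht⟩
    funext x
    apply le_antisymm
    · rcases eq_or_ne x ⊤ with rfl | hx
      · rw [ht]; exact le_top
      · have hx' : x < ⊤ := lt_top_iff_ne_top.2 hx
        refine le_of_forall_gt_imp_ge_of_dense fun t htx => sInf_le ?_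
        have : (nhdsWithin x (Set.Ioi x)).NeBot := nhdsGT_neBot_of_exists_gt ⟨⊤, hx'⟩
        obtain ⟨z, hz, hxz⟩ :=
          (((tendsto_order.1 (hc x)).2 t htx).and self_mem_nhdsWithin).exists
        refine lt_of_lt_of_le (show x < z from hxz) (le_sInf fun w (hw : t < F w) => ?_)
        by_contra hlt
        exact absurd (hm (not_le.1 hlt).le) (not_le.2 (hz.trans hw))
    · refine le_sInf fun t (h : x < dagger F t) => ?_
      by_contra hlt
      exact absurd (sInf_le (show x ∈ {x | F x > t} from not_le.1 hlt)) (not_le.2 h)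
end

section
/- Let F, G : EReal → EReal be monotone (non-decreasing) functions and write H† for the monotone generalized inverse H†(y) = sInf {x | H x > y}. Then (F ∘ G)†(y) ≤ G†(F†(y)) for every y ∈ EReal. Moreover, if G is strictly increasing, then (F ∘ G)† = G† ∘ F†. -/
open Set

theorem dagger_comp (F G : EReal → EReal) (hF : Monotone F) (hG : Monotone G) :
    (∀ y : EReal, dagger (F ∘ G) y ≤ dagger G (dagger F y)) ∧
    (StrictMono G → dagger (F ∘ G) = dagger G ∘ dagger F) := by
  have h1 : ∀ y : EReal, dagger (F ∘ G) y ≤ dagger G (dagger F y) := by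
    intro y
    refine le_sInf fun x hx => sInf_le ?_
    obtain ⟨z, hz, hzx⟩ := sInf_lt_iff.1 (show sInf {x : EReal | F x > y} < G x from hx)
    exact lt_of_lt_of_le (show y < F z from hz) (hF hzx.le)
  refine ⟨h1, fun hs => funext fun y => le_antisymm (h1 y) ?_⟩
  refine le_sInf fun x hx => ?_
  have ht : dagger F y ≤ G x := sInf_le hx
  refine le_of_forall_gt_imp_ge_of_dense fun a ha => ?_
  exact sInf_le (lt_of_le_of_lt ht (hs ha))
end

section
/- Let ν be a Borel probability measure on EReal with cumulative distribution function F(x) = (ν (Set.Iic x)).toReal viewed as an EReal-valued function, and let F†(y) = sInf {x : EReal | F x > y} be its monotone generalized inverse. Then for every y ∈ EReal, the Lebesgue measure of the set {t ∈ [0,1] ⊆ ℝ : F†(↑t) ≤ y} equals the Lebesgue measure of the set {t ∈ [0,1] ⊆ ℝ : (↑t : EReal) ≤ F y}. -/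
open MeasureTheory Set
open scoped ENNReal

/-- The CDF of a measure on `EReal`, viewed as a map `EReal → EReal`. -/
noncomputable def cdf (η : Measure EReal) : EReal → EReal :=
  fun x => ((η (Set.Iic x)).toReal : EReal)

theorem cdf_mono_aux (ν : Measure EReal) [IsProbabilityMeasure ν] {x z : EReal} (h : x ≤ z) :
    cdf ν x ≤ cdf ν z := by
  unfold cdf
  exact EReal.coe_le_coe_iff.2
    (ENNReal.toReal_mono (measure_ne_top _ _) (measure_mono (Iic_subset_Iic.2 h)))

theorem le_cdf_of_dagger_le (ν : Measure EReal) [IsProbabilityMeasure ν] (y : EReal) (t : ℝ)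
    (ht : t ≤ 1) (h : dagger (cdf ν) (t : EReal) ≤ y) : (t : EReal) ≤ cdf ν y := by
  rcases eq_or_ne y ⊤ with rfl | hy
  · simpa [cdf] using (by exact_mod_cast ht : (t : EReal) ≤ 1)
  have key : ∀ x, y < x → t ≤ (ν (Iic x)).toReal := by
    intro x hx
    obtain ⟨z, hz, hzx⟩ := sInf_lt_iff.1 (lt_of_le_of_lt h hx)
    have := lt_of_lt_of_le hz (cdf_mono_aux ν hzx.le)
    exact (EReal.coe_lt_coe_iff.1 this).le
  obtain ⟨u, hu, huy, hlim⟩ := exists_seq_strictAnti_tendsto' (lt_top_iff_ne_top.2 hy)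
  have hI : Iic y = ⋂ n, Iic (u n) := by
    ext z
    simp only [mem_Iic, mem_iInter]
    exact ⟨fun hz n => hz.trans (huy n).1.le, fun hz => ge_of_tendsto' hlim hz⟩
  have hT : Filter.Tendsto (fun n => ν (Iic (u n))) Filter.atTop (nhds (ν (Iic y))) := by
    rw [hI]
    exact tendsto_measure_iInter_atTop (fun n => measurableSet_Iic.nullMeasurableSet)
      (fun a b hab => Iic_subset_Iic.2 (hu.antitone hab)) ⟨0, measure_ne_top _ _⟩
  have hT2 := (ENNReal.tendsto_toReal (measure_ne_top ν (Iic y))).comp hT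
  exact EReal.coe_le_coe_iff.2 (ge_of_tendsto' hT2 (fun n => key _ (huy n).1))

theorem lebesgue_measure_of_generalized_inverse_sublevel (ν : Measure EReal)
    [IsProbabilityMeasure ν] (y : EReal) :
    volume {t : ℝ | t ∈ Set.Icc (0:ℝ) 1 ∧ dagger (cdf ν) (t : EReal) ≤ y} =
      volume {t : ℝ | t ∈ Set.Icc (0:ℝ) 1 ∧ (t : EReal) ≤ cdf ν y} := by
  apply measure_congr
  have h0 : ∀ᵐ t : ℝ, t ≠ (ν (Iic y)).toReal := by
    simp [ae_iff]
  filter_upwards [h0] with t ht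
  apply propext
  change (t ∈ Icc (0:ℝ) 1 ∧ dagger (cdf ν) (t : EReal) ≤ y) ↔
    (t ∈ Icc (0:ℝ) 1 ∧ (t : EReal) ≤ cdf ν y)
  refine and_congr_right fun hI => ⟨le_cdf_of_dagger_le ν y t hI.2, fun h => sInf_le ?_⟩
  exact lt_of_le_of_ne h (fun e => ht (EReal.coe_eq_coe_iff.1 e))
end

section
/- Let μ and ν be Borel probability measures on EReal, and assume μ gives no mass to atoms. Let F_μ and F_ν be their CDFs regarded as maps EReal → EReal (via toReal of μ(Iic x) and coercion), and let F_ν† be the monotone generalized inverse of F_ν. Then the map ψ = F_ν† ∘ F_μ : EReal → EReal is non-decreasing and satisfies ψ_# μ = ν, i.e. the pushforward of μ by ψ equals ν. -/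
open MeasureTheory Set
open scoped ENNReal

lemma left_aux (η : Measure EReal) (c : ℝ≥0∞) (a : EReal)
    (h : ∀ s < a, η (Iic s) ≤ c) : η (Iio a) ≤ c := by
  rcases eq_or_ne a ⊥ with rfl | ha
  · simp
  obtain ⟨u, hu, hlt, ht⟩ := exists_seq_strictMono_tendsto' (bot_lt_iff_ne_bot.2 ha)
  have e : Iio a = ⋃ n, Iic (u n) := by
    ext x
    simp only [mem_Iio, mem_iUnion, mem_Iic]
    constructor
    · intro hx
      obtain ⟨n, hn⟩ := (ht.eventually (lt_mem_nhds hx)).exists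
      exact ⟨n, hn.le⟩
    · rintro ⟨n, hn⟩
      exact hn.trans_lt (hlt n).2
  have hm : Monotone fun n => Iic (u n) := fun m n hmn => Iic_subset_Iic.2 (hu.monotone hmn)
  rw [e, hm.measure_iUnion]
  exact iSup_le fun n => h _ (hlt n).2

lemma right_aux (η : Measure EReal) [IsProbabilityMeasure η] (c : ℝ≥0∞) (a : EReal)
    (ha : a ≠ ⊤) (h : ∀ s > a, c ≤ η (Iic s)) : c ≤ η (Iic a) := by
  obtain ⟨u, hu, hlt, ht⟩ := exists_seq_strictAnti_tendsto' (lt_top_iff_ne_top.2 ha)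
  have e : Iic a = ⋂ n, Iic (u n) := by
    ext x
    simp only [mem_iInter, mem_Iic]
    constructor
    · intro hx n
      exact hx.trans (hlt n).1.le
    · intro hx
      exact ge_of_tendsto' ht hx
  have hm : Antitone fun n => Iic (u n) := fun m n hmn => Iic_subset_Iic.2 (hu.antitone hmn)
  rw [e, hm.measure_iInter (fun n => measurableSet_Iic.nullMeasurableSet)
    ⟨0, measure_ne_top _ _⟩]
  exact le_iInf fun n => h _ (hlt n).1

lemma cdf_lt_iff (μ ν : Measure EReal) [IsProbabilityMeasure μ] [IsProbabilityMeasure ν]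
    (x y : EReal) : cdf μ x < cdf ν y ↔ μ (Iic x) < ν (Iic y) := by
  unfold cdf
  rw [EReal.coe_lt_coe_iff, ENNReal.toReal_lt_toReal (measure_ne_top _ _) (measure_ne_top _ _)]

lemma upper_aux (μ : Measure EReal) [IsProbabilityMeasure μ] (c : ℝ≥0∞) :
    μ {x | μ (Iic x) ≤ c} ≤ c := by
  set S := {x | μ (Iic x) ≤ c} with hS
  have hlow : ∀ x ∈ S, ∀ y ≤ x, y ∈ S := fun x hx y hy =>
    (measure_mono (Iic_subset_Iic.2 hy)).trans hx
  by_cases ha : sSup S ∈ S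
  · exact (measure_mono (fun x hx => mem_Iic.2 (le_sSup hx))).trans ha
  · refine (measure_mono (t := Iio (sSup S)) fun x hx => ?_).trans (left_aux μ c _ ?_)
    · exact lt_of_le_of_ne (le_sSup hx) (fun h => ha (h ▸ hx))
    · intro s hs
      obtain ⟨x, hx, hsx⟩ := lt_sSup_iff.1 hs
      exact hlow x hx s hsx.le

lemma lower_aux (μ : Measure EReal) [IsProbabilityMeasure μ]
    (hatoms : ∀ x : EReal, μ {x} = 0) (c : ℝ≥0∞) (hc : c ≤ 1) :
    c ≤ μ {x | μ (Iic x) < c} := by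
  set b := sInf {x | c ≤ μ (Iic x)} with hb
  have hsub : Iio b ⊆ {x | μ (Iic x) < c} := by
    intro x hx
    by_contra hcon
    have h1 : x ∈ {x | c ≤ μ (Iic x)} := by
      simpa using hcon
    have h2 : b ≤ x := sInf_le h1
    exact absurd hx (not_lt.2 h2)
  have hbb : c ≤ μ (Iic b) := by
    rcases eq_or_ne b ⊤ with h | h
    · rw [h]; simpa using hc
    · refine right_aux μ c b h fun s hs => ?_
      obtain ⟨x, hx, hxs⟩ := sInf_lt_iff.1 hs
      exact le_trans hx (measure_mono (Iic_subset_Iic.2 hxs.le))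
  refine hbb.trans (le_trans ?_ (measure_mono hsub))
  rw [← Iio_union_right]
  refine (measure_union_le _ _).trans ?_
  simp [hatoms]

theorem monotone_map_pushforward (μ ν : Measure EReal)
    [IsProbabilityMeasure μ] [IsProbabilityMeasure ν]
    (hatoms : ∀ x : EReal, μ {x} = 0) :
    Monotone (dagger (cdf ν) ∘ cdf μ) ∧
    Measure.map (dagger (cdf ν) ∘ cdf μ) μ = ν := by
  have hmono : Monotone (dagger (cdf ν) ∘ cdf μ) := by
    intro x y hxy
    refine sInf_le_sInf fun z (hz : cdf μ y < cdf ν z) => ?_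
    change cdf μ x < cdf ν z
    refine lt_of_le_of_lt ?_ hz
    unfold cdf
    exact EReal.coe_le_coe_iff.2 (ENNReal.toReal_mono (measure_ne_top _ _)
      (measure_mono (Iic_subset_Iic.2 hxy)))
  refine ⟨hmono, ?_⟩
  have : IsProbabilityMeasure (Measure.map (dagger (cdf ν) ∘ cdf μ) μ) :=
    Measure.isProbabilityMeasure_map hmono.measurable.aemeasurable
  refine Measure.ext_of_Iic _ _ fun t => ?_
  rcases eq_or_ne t ⊤ with rfl | ht
  · simp
  rw [Measure.map_apply hmono.measurable measurableSet_Iic]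
  apply le_antisymm
  · refine (measure_mono fun x hx => ?_).trans (upper_aux μ (ν (Iic t)))
    refine right_aux ν _ t ht fun s hs => ?_
    obtain ⟨z, hz, hzs⟩ := sInf_lt_iff.1 (lt_of_le_of_lt hx hs)
    exact ((cdf_lt_iff μ ν x z).1 hz).le.trans (measure_mono (Iic_subset_Iic.2 hzs.le))
  · refine (lower_aux μ hatoms (ν (Iic t)) prob_le_one).trans (measure_mono fun x hx => ?_)
    have h1 : t ∈ {z | cdf ν z > cdf μ x} := (cdf_lt_iff μ ν x t).2 hx
    exact mem_preimage.2 (mem_Iic.2 (sInf_le h1))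
end

section
/- Uniqueness of the monotone transport map: let μ and ν be Borel probability measures on EReal with μ giving no mass to atoms. If φ : EReal → EReal is a non-decreasing measurable function such that φ_# μ = ν, then φ = F_ν† ∘ F_μ holds μ-almost everywhere, where F_μ, F_ν are the CDFs (as maps EReal → EReal) and F_ν† is the monotone generalized inverse of F_ν. -/
open MeasureTheory Set
open scoped ENNReal

lemma bad_null (μ : Measure EReal) [IsProbabilityMeasure μ]
    (hatoms : ∀ x : EReal, μ {x} = 0) (S : Set EReal) (hS : IsLowerSet S) :
    μ {t | t ∈ S ∧ μ S ≤ μ (Iic t)} = 0 := by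
  set A : Set EReal := {t | t ∈ S ∧ μ S ≤ μ (Iic t)} with hA
  rcases A.eq_empty_or_nonempty with h | h
  · rw [h]; simp
  obtain ⟨u, -, hu, huA⟩ := exists_seq_tendsto_sInf h (OrderBot.bddBelow A)
  have hsub : A ⊆ {sInf A} ∪ ⋃ n, (S \ Iic (u n)) := by
    intro t ht
    rcases (sInf_le ht).eq_or_lt with h1 | h1
    · left; exact h1.symm
    · right
      obtain ⟨n, hn⟩ := (hu.eventually (gt_mem_nhds h1)).exists
      exact mem_iUnion.2 ⟨n, ht.1, not_le.2 hn⟩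
  refine measure_mono_null hsub (measure_union_null (hatoms _) (measure_iUnion_null fun n => ?_))
  have hn := huA n
  have hs : Iic (u n) ⊆ S := fun x hx => hS hx hn.1
  rw [measure_sdiff hs measurableSet_Iic.nullMeasurableSet (measure_ne_top _ _)]
  exact tsub_eq_zero_of_le hn.2

theorem monotone_transport_map_unique (μ ν : Measure EReal)
    [IsProbabilityMeasure μ] [IsProbabilityMeasure ν]
    (hatoms : ∀ x : EReal, μ {x} = 0)
    (φ : EReal → EReal) (hφmono : Monotone φ) (hφmeas : Measurable φ)
    (hpush : Measure.map φ μ = ν) :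
    φ =ᵐ[μ] dagger (cdf ν) ∘ cdf μ := by
  have hν : ∀ x, ν (Iic x) = μ (φ ⁻¹' Iic x) := fun x => by
    rw [← hpush, Measure.map_apply hφmeas measurableSet_Iic]
  have hlt : ∀ x t, cdf ν x > cdf μ t ↔ μ (Iic t) < μ (φ ⁻¹' Iic x) := fun x t => by
    unfold cdf
    rw [gt_iff_lt, EReal.coe_lt_coe_iff, hν,
      ENNReal.toReal_lt_toReal (measure_ne_top _ _) (measure_ne_top _ _)]
  obtain ⟨D, hDc, hD⟩ := TopologicalSpace.exists_countable_dense EReal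
  have hae : ∀ᵐ t ∂μ, ∀ q ∈ D, ¬ (t ∈ φ ⁻¹' Iic q ∧ μ (φ ⁻¹' Iic q) ≤ μ (Iic t)) := by
    rw [ae_ball_iff hDc]
    intro q _
    rw [ae_iff]
    simp only [not_not]
    exact bad_null μ hatoms _ fun a b hba ha => (hφmono hba).trans ha
  filter_upwards [hae] with t ht
  apply le_antisymm
  · refine le_sInf fun x hx => ?_
    have hx' := (hlt x t).1 hx
    by_contra hc
    refine absurd (measure_mono (μ := μ) ?_) (not_le.2 hx')
    intro s hs
    by_contra hst
    exact hc ((hφmono (not_le.1 hst).le).trans hs)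
  · by_contra hc
    obtain ⟨q, hq, h1, h2⟩ := hD.exists_between (not_le.1 hc)
    refine ht q hq ⟨h1.le, ?_⟩
    by_contra h3
    have h4 : q ∈ {x : EReal | cdf ν x > cdf μ t} := (hlt q t).2 (not_le.1 h3)
    exact absurd (sInf_le h4) (not_le.2 h2)
end

section
/- CDT bijection for probability measures: let μ₀ be a Borel probability measure on EReal that gives no mass to atoms, and for each Borel probability measure ν on EReal define its transform ν̂ = F_ν† ∘ F_{μ₀} : EReal → EReal. Then: (injectivity) if ν, η are probability measures with ν̂ = η̂ μ₀-almost everywhere, then ν = η; (surjectivity) for every function φ : EReal → EReal that is non-decreasing μ₀-almost everywhere and measurable, the probability measure ν = φ_# μ₀ satisfies ν̂ = φ μ₀-almost everywhere; and the inverse of the transform is given by φ ↦ φ_# μ₀. -/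
open MeasureTheory Set
open scoped ENNReal

/-- The cumulative distribution transform of `ν` with respect to the reference `μ₀`. -/
noncomputable def cdt (μ₀ ν : Measure EReal) : EReal → EReal :=
  dagger (cdf ν) ∘ cdf μ₀

open Filter Topology in
lemma aux_R (ν : Measure EReal) [IsProbabilityMeasure ν] (z : EReal) (c : ℝ≥0∞) (hc : c ≤ 1)
    (h : ∀ w, z < w → c ≤ ν (Iic w)) : c ≤ ν (Iic z) := by
  rcases eq_or_ne z ⊤ with rfl | hz
  · simpa using hc
  obtain ⟨u, hu, hu1, hu2⟩ := exists_seq_strictAnti_tendsto' (lt_top_iff_ne_top.2 hz)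
  have hI : ⋂ n, Iic (u n) = Iic z := by
    ext x
    simp only [mem_iInter, mem_Iic]
    exact ⟨fun hx => ge_of_tendsto' hu2 hx, fun hx n => hx.trans (hu1 n).1.le⟩
  have ht := tendsto_measure_iInter_atTop (μ := ν) (s := fun n => Iic (u n))
    (fun n => measurableSet_Iic.nullMeasurableSet)
    (fun m n hmn => Iic_subset_Iic.2 (hu.antitone hmn)) ⟨0, measure_ne_top _ _⟩
  rw [hI] at ht
  exact ge_of_tendsto' ht fun n => h _ (hu1 n).1

open Filter Topology in
lemma aux_L (ν : Measure EReal) (z : EReal) (c : ℝ≥0∞)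
    (h : ∀ w, w < z → ν (Iic w) ≤ c) : ν (Iio z) ≤ c := by
  rcases eq_or_ne z ⊥ with rfl | hz
  · simp
  obtain ⟨u, hu, hu1, hu2⟩ := exists_seq_strictMono_tendsto' (bot_lt_iff_ne_bot.2 hz)
  have hI : ⋃ n, Iic (u n) = Iio z := by
    ext x
    simp only [mem_iUnion, mem_Iic, mem_Iio]
    constructor
    · rintro ⟨n, hn⟩
      exact hn.trans_lt (hu1 n).2
    · intro hx
      obtain ⟨n, hn⟩ := (hu2.eventually (lt_mem_nhds hx)).exists
      exact ⟨n, hn.le⟩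
  have ht := tendsto_measure_iUnion_atTop (μ := ν) (s := fun n => Iic (u n))
    (fun m n hmn => Iic_subset_Iic.2 (hu.monotone hmn))
  rw [hI] at ht
  exact le_of_tendsto' ht fun n => h _ (hu1 n).2

lemma aux_Iic_Iio (μ : Measure EReal) (hat : ∀ x : EReal, μ {x} = 0) (a : EReal) :
    μ (Iic a) ≤ μ (Iio a) := by
  rw [← Iio_union_right]
  exact (measure_union_le _ _).trans (by simp [hat])

lemma aux_le (μ : Measure EReal) (hat : ∀ x : EReal, μ {x} = 0) (c : ℝ≥0∞) :
    μ {x | μ (Iic x) ≤ c} ≤ c := by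
  have hs : {x | μ (Iic x) ≤ c} ⊆ Iic (sSup {x | μ (Iic x) ≤ c}) := fun x hx => le_sSup hx
  refine (measure_mono hs).trans ((aux_Iic_Iio μ hat _).trans (aux_L μ _ c ?_))
  intro w hw
  obtain ⟨v, hv, hwv⟩ := lt_sSup_iff.1 hw
  exact (measure_mono (Iic_subset_Iic.2 hwv.le)).trans hv

lemma aux_ge (μ : Measure EReal) [IsProbabilityMeasure μ] (hat : ∀ x : EReal, μ {x} = 0)
    (c : ℝ≥0∞) (hc : c ≤ 1) : c ≤ μ {x | μ (Iic x) < c} := by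
  have hs : Iio (sInf {x | c ≤ μ (Iic x)}) ⊆ {x | μ (Iic x) < c} := by
    intro x hx
    by_contra hcon
    rw [mem_setOf_eq, not_lt] at hcon
    have hmem : x ∈ {x | c ≤ μ (Iic x)} := hcon
    exact absurd (sInf_le hmem) (not_le.2 hx)
  refine le_trans (aux_R μ _ c hc ?_) ((aux_Iic_Iio μ hat _).trans (measure_mono hs))
  intro w hw
  obtain ⟨v, hv, hwv⟩ := sInf_lt_iff.1 hw
  exact le_trans hv (measure_mono (Iic_subset_Iic.2 hwv.le))

lemma aux_cdf_lt (μ ν : Measure EReal) [IsProbabilityMeasure μ] [IsProbabilityMeasure ν]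
    (x y : EReal) : cdf ν y > cdf μ x ↔ μ (Iic x) < ν (Iic y) := by
  unfold cdf
  rw [gt_iff_lt, EReal.coe_lt_coe_iff,
    ENNReal.toReal_lt_toReal (measure_ne_top _ _) (measure_ne_top _ _)]

lemma aux_cdt (μ ν : Measure EReal) [IsProbabilityMeasure μ] [IsProbabilityMeasure ν]
    (x : EReal) : cdt μ ν x = sInf {y | μ (Iic x) < ν (Iic y)} := by
  simp only [cdt, dagger, Function.comp, aux_cdf_lt]

lemma aux_mono (μ ν : Measure EReal) [IsProbabilityMeasure μ] [IsProbabilityMeasure ν] :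
    Monotone (cdt μ ν) := by
  intro x y hxy
  rw [aux_cdt, aux_cdt]
  exact sInf_le_sInf fun z hz => (measure_mono (Iic_subset_Iic.2 hxy)).trans_lt hz

lemma aux_map (μ ν : Measure EReal) [IsProbabilityMeasure μ] [IsProbabilityMeasure ν]
    (hat : ∀ x : EReal, μ {x} = 0) : Measure.map (cdt μ ν) μ = ν := by
  have hm : Measurable (cdt μ ν) := (aux_mono μ ν).measurable
  have : IsProbabilityMeasure (Measure.map (cdt μ ν) μ) :=
    Measure.isProbabilityMeasure_map hm.aemeasurable
  refine Measure.ext_of_Iic _ _ fun z => ?_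
  rw [Measure.map_apply hm measurableSet_Iic]
  apply le_antisymm
  · refine le_trans (measure_mono ?_) (aux_le μ hat (ν (Iic z)))
    intro x hx
    rw [mem_preimage, mem_Iic, aux_cdt] at hx
    refine aux_R ν z _ prob_le_one fun w hw => ?_
    obtain ⟨v, hv, hwv⟩ := sInf_lt_iff.1 (hx.trans_lt hw)
    exact le_trans (le_of_lt hv) (measure_mono (Iic_subset_Iic.2 hwv.le))
  · refine le_trans (aux_ge μ hat (ν (Iic z)) prob_le_one) (measure_mono ?_)
    intro x hx
    rw [mem_preimage, mem_Iic, aux_cdt]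
    exact sInf_le hx

lemma aux_unique (μ : Measure EReal) [IsProbabilityMeasure μ] (f g : EReal → EReal)
    (hf : Monotone f) (hg : Monotone g) (h : Measure.map f μ = Measure.map g μ) :
    f =ᵐ[μ] g := by
  obtain ⟨D, hDc, hD⟩ := TopologicalSpace.exists_countable_dense EReal
  have key : ∀ q ∈ D, ∀ᵐ x ∂μ, (f x ≤ q ↔ g x ≤ q) := by
    intro q _
    have hmf : MeasurableSet (f ⁻¹' Iic q) := hf.measurable measurableSet_Iic
    have hmg : MeasurableSet (g ⁻¹' Iic q) := hg.measurable measurableSet_Iic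
    have he : μ (f ⁻¹' Iic q) = μ (g ⁻¹' Iic q) := by
      rw [← Measure.map_apply hf.measurable measurableSet_Iic, h,
        Measure.map_apply hg.measurable measurableSet_Iic]
    have hae : f ⁻¹' Iic q =ᵐ[μ] g ⁻¹' Iic q := by
      rcases IsLowerSet.total (s := f ⁻¹' Iic q) (t := g ⁻¹' Iic q)
        (fun a b hab ha => (hf hab).trans ha) (fun a b hab ha => (hg hab).trans ha) with hs | hs
      · exact ae_eq_of_subset_of_measure_ge hs he.ge hmf.nullMeasurableSet (measure_ne_top _ _)
      · exact (ae_eq_of_subset_of_measure_ge hs he.le hmg.nullMeasurableSet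
          (measure_ne_top _ _)).symm
    exact hae.mem_iff
  have key2 := (ae_ball_iff hDc).2 key
  filter_upwards [key2] with x hx
  have gen : ∀ a b : EReal, (∀ q ∈ D, a ≤ q → b ≤ q) → b ≤ a := by
    intro a b hab
    by_contra hcon
    obtain ⟨q, hq, h1, h2⟩ := hD.exists_between (not_le.1 hcon)
    exact absurd (hab q hq h1.le) (not_le.2 h2)
  exact le_antisymm (gen _ _ fun q hq => (hx q hq).2) (gen _ _ fun q hq => (hx q hq).1)

theorem cdt_bijection_probability_measures (μ₀ : Measure EReal)
    [IsProbabilityMeasure μ₀] (hatoms : ∀ x : EReal, μ₀ {x} = 0) :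
    -- injectivity
    (∀ (ν η : Measure EReal), IsProbabilityMeasure ν → IsProbabilityMeasure η →
      cdt μ₀ ν =ᵐ[μ₀] cdt μ₀ η → ν = η) ∧
    -- surjectivity: every (a.e.) non-decreasing measurable function is the transform
    -- of its own pushforward of `μ₀`
    (∀ φ : EReal → EReal, Measurable φ →
      (∃ ψ : EReal → EReal, Monotone ψ ∧ φ =ᵐ[μ₀] ψ) →
      cdt μ₀ (Measure.map φ μ₀) =ᵐ[μ₀] φ) ∧
    -- the inverse of the transform is the pushforward `φ ↦ φ_# μ₀`
    (∀ ν : Measure EReal, IsProbabilityMeasure ν →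
      Measure.map (cdt μ₀ ν) μ₀ = ν) := by
  refine ⟨?_, ?_, ?_⟩
  · intro ν η _ _ h
    rw [← aux_map μ₀ ν hatoms, ← aux_map μ₀ η hatoms]
    exact Measure.map_congr h
  · rintro φ hφ ⟨ψ, hψ, h⟩
    have : IsProbabilityMeasure (Measure.map φ μ₀) :=
      Measure.isProbabilityMeasure_map hφ.aemeasurable
    refine (aux_unique μ₀ _ ψ (aux_mono _ _) hψ ?_).trans h.symm
    rw [aux_map μ₀ _ hatoms]
    exact Measure.map_congr h
  · intro ν _
    exact aux_map μ₀ ν hatoms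
end

section
/- CDT bijection for finite positive measures: let μ₀ be a nontrivial finite positive Borel measure on EReal (0 < μ₀(EReal) < ∞) that gives no mass to atoms. For a nonzero finite positive Borel measure ν, define ν⋆ = F_{ν/‖ν‖}† ∘ F_{μ₀/‖μ₀‖}, where ‖ν‖ = ν(EReal), and set ν̂ = (ν⋆, ‖ν‖), with the zero measure mapped to (0, 0). Then: (injectivity) if ν, η are nonzero finite positive measures with ‖ν‖ = ‖η‖ and ν⋆ = η⋆ μ₀-a.e., then ν = η; (surjectivity and inversion) for every measurable f : EReal → EReal non-decreasing μ₀-a.e. and every r > 0, the measure ν = r · f_#(μ₀/‖μ₀‖) is a finite positive measure with ‖ν‖ = r and ν⋆ = f μ₀-a.e. -/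
open MeasureTheory Set
open scoped ENNReal NNReal

/-- The normalization `ν / ‖ν‖` of a (nonzero finite) measure. -/
noncomputable def normalized (μ : Measure EReal) : Measure EReal :=
  ((μ Set.univ).toNNReal)⁻¹ • μ

/-- The transform `ν⋆ = F_{ν/‖ν‖}† ∘ F_{μ₀/‖μ₀‖}`. -/
noncomputable def starTransform (μ₀ ν : Measure EReal) : EReal → EReal :=
  dagger (cdf (normalized ν)) ∘ cdf (normalized μ₀)

theorem cdt_normalized_prob (ν : Measure EReal) [IsFiniteMeasure ν] (h : ν ≠ 0) :
    IsProbabilityMeasure (normalized ν) := by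
  constructor
  have h0 : ν Set.univ ≠ 0 := by simpa using h
  have h1 : ν Set.univ ≠ ∞ := measure_ne_top _ _
  have h2 : (ν Set.univ).toNNReal ≠ 0 := by
    simp [ENNReal.toNNReal_eq_zero_iff, h0, h1]
  rw [normalized, Measure.smul_apply, ENNReal.smul_def, smul_eq_mul, ENNReal.coe_inv h2,
    ENNReal.coe_toNNReal h1, ENNReal.inv_mul_cancel h0 h1]

theorem cdt_smul_normalized (ν : Measure EReal) [IsFiniteMeasure ν] (h : ν ≠ 0) :
    (ν Set.univ).toNNReal • normalized ν = ν := by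
  have h0 : ν Set.univ ≠ 0 := by simpa using h
  have h1 : ν Set.univ ≠ ∞ := measure_ne_top _ _
  have h2 : (ν Set.univ).toNNReal ≠ 0 := by
    simp [ENNReal.toNNReal_eq_zero_iff, h0, h1]
  rw [normalized, smul_smul, mul_inv_cancel₀ h2, one_smul]

theorem cdt_cdf_lt (μ ρ : Measure EReal) [IsFiniteMeasure μ] [IsFiniteMeasure ρ] (x y : EReal) :
    cdf μ x < cdf ρ y ↔ μ (Iic x) < ρ (Iic y) := by
  rw [cdf, cdf, EReal.coe_lt_coe_iff,
    ENNReal.toReal_lt_toReal (measure_ne_top _ _) (measure_ne_top _ _)]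

/-- right continuity -/
theorem cdt_right (ρ : Measure EReal) [IsProbabilityMeasure ρ] (c : EReal) (t : ℝ≥0∞)
    (ht : t ≤ 1) (h : ∀ x, c < x → t ≤ ρ (Iic x)) : t ≤ ρ (Iic c) := by
  rcases eq_or_ne c ⊤ with rfl | hc
  · simpa using ht
  obtain ⟨u, hu, hu', hlim⟩ := exists_seq_strictAnti_tendsto' (lt_top_iff_ne_top.2 hc)
  have hI : Iic c = ⋂ n, Iic (u n) := by
    ext x
    simp only [mem_Iic, mem_iInter]
    exact ⟨fun hx n => hx.trans (hu' n).1.le, fun hx => ge_of_tendsto' hlim hx⟩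
  rw [hI, Antitone.measure_iInter (fun i j hij => Iic_subset_Iic.2 (hu.antitone hij))
    (fun i => measurableSet_Iic.nullMeasurableSet) ⟨0, measure_ne_top _ _⟩]
  exact le_iInf fun n => h _ (hu' n).1

/-- left continuity -/
theorem cdt_left (μ : Measure EReal) (hat : ∀ x, μ {x} = 0) (c : EReal) (t : ℝ≥0∞)
    (h : ∀ x, x < c → μ (Iic x) ≤ t) : μ (Iic c) ≤ t := by
  rcases eq_or_ne c ⊥ with rfl | hc
  · simp [hat]
  obtain ⟨u, hu, hu', hlim⟩ := exists_seq_strictMono_tendsto' (bot_lt_iff_ne_bot.2 hc)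
  have hI : Iic c ⊆ {c} ∪ ⋃ n, Iic (u n) := by
    intro x hx
    rcases eq_or_lt_of_le (mem_Iic.1 hx) with rfl | hx
    · simp
    · obtain ⟨n, hn⟩ := (hlim.eventually (lt_mem_nhds hx)).exists
      exact Or.inr (mem_iUnion.2 ⟨n, hn.le⟩)
  refine (measure_mono hI).trans ((measure_union_le _ _).trans ?_)
  rw [hat, zero_add, Monotone.measure_iUnion (fun i j hij => Iic_subset_Iic.2 (hu.monotone hij))]
  exact iSup_le fun n => h _ (hu' n).2

theorem cdt_unif_le (μ : Measure EReal) (hat : ∀ x, μ {x} = 0) (t : ℝ≥0∞) :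
    μ {z | μ (Iic z) ≤ t} ≤ t := by
  set S := {z | μ (Iic z) ≤ t} with hS
  have hsub : S ⊆ Iic (sSup S) := fun z hz => le_sSup hz
  refine (measure_mono hsub).trans (cdt_left μ hat _ _ fun x hx => ?_)
  obtain ⟨z, hz, hxz⟩ := lt_sSup_iff.1 hx
  exact (measure_mono (Iic_subset_Iic.2 hxz.le)).trans hz

theorem cdt_unif_ge (μ : Measure EReal) [IsProbabilityMeasure μ] (hat : ∀ x, μ {x} = 0)
    (t : ℝ≥0∞) (ht : t ≤ 1) :
    t ≤ μ {z | μ (Iic z) < t} := by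
  set S := {z | t ≤ μ (Iic z)} with hS
  have h1 : t ≤ μ (Iic (sInf S)) := by
    refine cdt_right μ _ _ ht fun x hx => ?_
    obtain ⟨z, hz, hxz⟩ := sInf_lt_iff.1 hx
    exact le_trans hz (measure_mono (Iic_subset_Iic.2 hxz.le))
  have hsub : Iic (sInf S) ⊆ {sInf S} ∪ {z | μ (Iic z) < t} := by
    intro x hx
    rcases eq_or_lt_of_le (mem_Iic.1 hx) with rfl | hx
    · simp
    · right
      by_contra hcon
      have hc : t ≤ μ (Iic x) := not_lt.1 hcon
      have hxS : x ∈ S := hc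
      exact absurd (sInf_le hxS) (not_le.2 hx)
  refine h1.trans ((measure_mono hsub).trans ((measure_union_le _ _).trans ?_))
  rw [hat, zero_add]

theorem cdt_push (μ ρ : Measure EReal) [IsProbabilityMeasure μ] [IsProbabilityMeasure ρ]
    (hat : ∀ x, μ {x} = 0) (x : EReal) :
    μ {z | dagger (cdf ρ) (cdf μ z) ≤ x} = ρ (Iic x) := by
  apply le_antisymm
  · refine le_trans (measure_mono ?_) (cdt_unif_le μ hat (ρ (Iic x)))
    intro z hz
    refine cdt_right ρ x _ prob_le_one fun x' hx' => ?_
    obtain ⟨s, hs, hsx⟩ := sInf_lt_iff.1 (lt_of_le_of_lt (show sInf _ ≤ x from hz) hx')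
    exact ((cdt_cdf_lt μ ρ z s).1 hs).le.trans (measure_mono (Iic_subset_Iic.2 hsx.le))
  · refine le_trans (cdt_unif_ge μ hat (ρ (Iic x)) prob_le_one) (measure_mono ?_)
    intro z hz
    have h1 : cdf μ z < cdf ρ x := (cdt_cdf_lt μ ρ z x).2 hz
    have h2 : x ∈ {x : EReal | cdf ρ x > cdf μ z} := h1
    have h3 : dagger (cdf ρ) (cdf μ z) ≤ x := sInf_le h2
    exact h3

theorem cdt_monotone (μ ρ : Measure EReal) [IsFiniteMeasure μ] :
    Monotone (fun z => dagger (cdf ρ) (cdf μ z)) := by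
  intro a b hab
  have h : cdf μ a ≤ cdf μ b := by
    rw [cdf, cdf, EReal.coe_le_coe_iff]
    exact ENNReal.toReal_mono (measure_ne_top _ _) (measure_mono (Iic_subset_Iic.2 hab))
  refine sInf_le_sInf fun x hx => ?_
  have hx' : cdf μ b < cdf ρ x := hx
  exact lt_of_le_of_lt h hx'

theorem cdt_bijection_finite_measures (μ₀ : Measure EReal) [IsFiniteMeasure μ₀]
    (hμ₀ : μ₀ ≠ 0) (hatoms : ∀ x : EReal, μ₀ {x} = 0) :
    -- injectivity
    (∀ (ν η : Measure EReal), IsFiniteMeasure ν → IsFiniteMeasure η → ν ≠ 0 → η ≠ 0 →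
      ν Set.univ = η Set.univ → starTransform μ₀ ν =ᵐ[μ₀] starTransform μ₀ η → ν = η) ∧
    -- surjectivity and inversion
    (∀ f : EReal → EReal, Measurable f →
      (∃ ψ : EReal → EReal, Monotone ψ ∧ f =ᵐ[μ₀] ψ) →
      ∀ r : ℝ≥0, 0 < r →
        IsFiniteMeasure (r • Measure.map f (normalized μ₀)) ∧
        (r • Measure.map f (normalized μ₀)) Set.univ = (r : ℝ≥0∞) ∧
        starTransform μ₀ (r • Measure.map f (normalized μ₀)) =ᵐ[μ₀] f) := by
  have hP := cdt_normalized_prob μ₀ hμ₀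
  have hat : ∀ x, normalized μ₀ {x} = 0 := fun x => by simp [normalized, hatoms]
  have hac : normalized μ₀ ≪ μ₀ := by
    rw [normalized]; exact Measure.smul_absolutelyContinuous
  have hca : μ₀ ≪ normalized μ₀ := by
    conv_lhs => rw [← cdt_smul_normalized μ₀ hμ₀]
    exact Measure.smul_absolutelyContinuous
  refine ⟨?_, ?_⟩
  · intro ν η hν hη hν0 hη0 hmass hae
    have hPν := cdt_normalized_prob ν hν0
    have hPη := cdt_normalized_prob η hη0
    have hn : normalized ν = normalized η := by
      refine Measure.ext_of_Iic _ _ fun x => ?_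
      rw [← cdt_push (normalized μ₀) (normalized ν) hat x,
        ← cdt_push (normalized μ₀) (normalized η) hat x]
      refine measure_congr ?_
      filter_upwards [hac.ae_le hae] with z hz
      have hz' : dagger (cdf (normalized ν)) (cdf (normalized μ₀) z)
        = dagger (cdf (normalized η)) (cdf (normalized μ₀) z) := hz
      exact congrArg (fun w => w ≤ x) hz'
    rw [← cdt_smul_normalized ν hν0, ← cdt_smul_normalized η hη0, hn, hmass]
  · rintro f hf ⟨ψ, hψ, hfψ⟩ r hr
    set μ := normalized μ₀ with hμ
    have hPm : IsProbabilityMeasure (Measure.map f μ) :=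
      Measure.isProbabilityMeasure_map hf.aemeasurable
    have hmass : (r • Measure.map f μ) Set.univ = (r : ℝ≥0∞) := by
      rw [Measure.smul_apply, measure_univ, ENNReal.smul_def, smul_eq_mul, mul_one]
    refine ⟨inferInstance, hmass, ?_⟩
    have hnorm : normalized (r • Measure.map f μ) = Measure.map f μ := by
      rw [normalized, hmass, ENNReal.toNNReal_coe, smul_smul, inv_mul_cancel₀ hr.ne', one_smul]
    have hfψ' : f =ᵐ[μ] ψ := hac.ae_le hfψ
    have hG : ∀ x, Measure.map f μ (Iic x) = μ {z | ψ z ≤ x} := by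
      intro x
      rw [Measure.map_apply hf measurableSet_Iic]
      refine measure_congr ?_
      filter_upwards [hfψ'] with z hz
      exact congrArg (fun w => w ≤ x) hz
    set T : EReal → EReal := fun z => dagger (cdf (Measure.map f μ)) (cdf μ z) with hT
    have hle : ∀ z, ψ z ≤ T z := by
      intro z
      refine le_sInf fun x hx => ?_
      have hx' := (cdt_cdf_lt μ (Measure.map f μ) z x).1 hx
      rw [hG] at hx'
      by_contra hcon
      refine absurd hx' (not_lt.2 (measure_mono fun w hw => ?_))
      by_contra hwz
      exact hcon ((hψ (not_le.1 hwz).le).trans hw)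
    have hTm : Measurable T := (cdt_monotone μ _).measurable
    have hq : ∀ q : ℚ, ∀ᵐ z ∂μ, ¬ (ψ z ≤ ((q : ℝ) : EReal) ∧ ((q : ℝ) : EReal) < T z) := by
      intro q
      rw [ae_iff]
      have hset : {z | ¬ ¬ (ψ z ≤ ((q : ℝ) : EReal) ∧ ((q : ℝ) : EReal) < T z)}
          = {z | ψ z ≤ ((q : ℝ) : EReal)} \ {z | T z ≤ ((q : ℝ) : EReal)} := by
        ext z; simp
      have hTs : MeasurableSet {z | T z ≤ ((q : ℝ) : EReal)} := hTm measurableSet_Iic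
      have hsub : {z | T z ≤ ((q : ℝ) : EReal)} ⊆ {z | ψ z ≤ ((q : ℝ) : EReal)} :=
        fun z hz => (hle z).trans hz
      rw [hset, measure_sdiff hsub hTs.nullMeasurableSet
        (measure_ne_top _ _), cdt_push μ (Measure.map f μ) hat, hG, tsub_self]
    have hfin : T =ᵐ[μ] f := by
      filter_upwards [ae_all_iff.2 hq, hfψ'] with z hz hz2
      rw [hz2]
      refine le_antisymm ?_ (hle z)
      by_contra hcon
      obtain ⟨q, h1, h2⟩ := EReal.lt_iff_exists_rat_btwn.1 (not_le.1 hcon)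
      exact hz q ⟨h1.le, h2⟩
    refine hca.ae_le ?_
    unfold starTransform
    rw [hnorm]
    exact hfin
end

section
/- SCDT bijection for signed measures (inversion formula): let μ₀ be a nontrivial finite positive Borel measure on EReal that gives no mass to atoms. Let f, g : EReal → EReal be measurable, non-decreasing μ₀-a.e. functions and r, s > 0 real numbers such that the pushforwards f_# μ₀ and g_# μ₀ are mutually singular. Then the signed measure ν = r · f_#(μ₀/‖μ₀‖) − s · g_#(μ₀/‖μ₀‖) has Jordan decomposition ν⁺ = r · f_#(μ₀/‖μ₀‖) and ν⁻ = s · g_#(μ₀/‖μ₀‖); in particular ‖ν⁺‖ = r, ‖ν⁻‖ = s, and (ν⁺/r)⋆ = f and (ν⁻/s)⋆ = g hold μ₀-a.e., where η⋆ = F_{η/‖η‖}† ∘ F_{μ₀/‖μ₀‖}. Consequently the map ν ↦ ((ν⁺)⋆, ‖ν⁺‖, (ν⁻)⋆, ‖ν⁻‖) is injective on finite signed Borel measures on EReal with both Jordan parts nonzero. -/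
open MeasureTheory Set
open scoped ENNReal NNReal

instance (μ : Measure EReal) [IsFiniteMeasure μ] : IsFiniteMeasure (normalized μ) := by
  unfold normalized; infer_instance

lemma nnsmul_app (c : ℝ≥0) (μ : Measure EReal) (s : Set EReal) :
    (c • μ) s = (c : ℝ≥0∞) * μ s := rfl

lemma normalized_prob (μ : Measure EReal) [IsFiniteMeasure μ] (h : μ ≠ 0) :
    IsProbabilityMeasure (normalized μ) := by
  constructor
  have h0 : μ univ ≠ 0 := by simpa using h
  have h1 : μ univ ≠ ∞ := measure_ne_top _ _
  lift μ univ to ℝ≥0 using h1 with m hm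
  have hm0 : m ≠ 0 := by simpa using h0
  rw [normalized, nnsmul_app, ← hm]
  simp only [ENNReal.toNNReal_coe]
  rw [← ENNReal.coe_mul, inv_mul_cancel₀ hm0, ENNReal.coe_one]

lemma normalized_smul_prob (η : Measure EReal) [IsProbabilityMeasure η] (r : ℝ≥0) (hr : 0 < r) :
    normalized (r • η) = η := by
  rw [normalized, nnsmul_app, measure_univ, mul_one, ENNReal.toNNReal_coe,
    smul_smul, inv_mul_cancel₀ hr.ne', one_smul]

lemma ae_normalized (μ : Measure EReal) [IsFiniteMeasure μ] (h : μ ≠ 0) :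
    ae (normalized μ) = ae μ := by
  have h0 : μ univ ≠ 0 := by simpa using h
  have h1 : μ univ ≠ ∞ := measure_ne_top _ _
  have hc : (μ univ).toNNReal⁻¹ ≠ 0 :=
    inv_ne_zero ((ENNReal.toNNReal_ne_zero).2 ⟨h0, h1⟩)
  ext s
  simp only [mem_ae_iff, normalized, nnsmul_app, mul_eq_zero]
  simp only [ENNReal.coe_eq_zero, hc, false_or]

lemma smul_normalized (μ : Measure EReal) [IsFiniteMeasure μ] (h : μ ≠ 0) :
    (μ univ).toNNReal • normalized μ = μ := by
  have h0 : μ univ ≠ 0 := by simpa using h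
  have h1 : μ univ ≠ ∞ := measure_ne_top _ _
  rw [normalized, smul_smul, mul_inv_cancel₀ ((ENNReal.toNNReal_ne_zero).2 ⟨h0, h1⟩), one_smul]

lemma cdf_le_cdf_iff (P Q : Measure EReal) [IsFiniteMeasure P] [IsFiniteMeasure Q] (x y : EReal) :
    cdf P x ≤ cdf Q y ↔ P (Iic x) ≤ Q (Iic y) := by
  rw [cdf, cdf, EReal.coe_le_coe_iff, ENNReal.toReal_le_toReal (measure_ne_top _ _)
    (measure_ne_top _ _)]

lemma cdf_lt_cdf_iff (P Q : Measure EReal) [IsFiniteMeasure P] [IsFiniteMeasure Q] (x y : EReal) :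
    cdf P x < cdf Q y ↔ P (Iic x) < Q (Iic y) := by
  rw [cdf, cdf, EReal.coe_lt_coe_iff, ENNReal.toReal_lt_toReal (measure_ne_top _ _)
    (measure_ne_top _ _)]

/-- tail sets of a lower set are null -/
lemma null_tail (P : Measure EReal) (hP : ∀ x, P {x} = 0) (B : Set EReal)
    (hB : ∀ x ∈ B, P (B ∩ Ioi x) = 0) : P B = 0 := by
  by_cases h : ∃ x ∈ B, ∀ y ∈ B, x ≤ y
  · obtain ⟨x, hx, hxy⟩ := h
    refine measure_mono_null (t := {x} ∪ (B ∩ Ioi x)) ?_ (measure_union_null (hP x) (hB x hx))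
    intro y hy
    rcases (hxy y hy).eq_or_lt with h | h
    · exact Or.inl h.symm
    · exact Or.inr ⟨hy, h⟩
  · push Not at h
    refine measure_null_of_locally_null B fun x hx => ?_
    obtain ⟨y, hy, hyx⟩ := h x hx
    exact ⟨B ∩ Ioi y, Filter.inter_mem self_mem_nhdsWithin
      (mem_nhdsWithin_of_mem_nhds (Ioi_mem_nhds hyx)), hB y hy⟩

lemma dagger_recover (P : Measure EReal) [IsProbabilityMeasure P] (hP : ∀ x, P {x} = 0)
    (ψ : EReal → EReal) (hψ : Monotone ψ) :
    dagger (cdf (Measure.map ψ P)) ∘ cdf P =ᵐ[P] ψ := by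
  have hm : Measurable ψ := hψ.measurable
  have hap : ∀ y, Measure.map ψ P (Iic y) = P {x | ψ x ≤ y} := fun y =>
    Measure.map_apply hm measurableSet_Iic
  have hmS : ∀ y, MeasurableSet {x | ψ x ≤ y} := fun y => hm measurableSet_Iic
  obtain ⟨D, hDc, hDd⟩ := TopologicalSpace.exists_countable_dense EReal
  have key : ∀ᵐ x ∂P, ∀ q ∈ D, ¬ (ψ x ≤ q ∧ P {z | ψ z ≤ q} ≤ P (Iic x)) := by
    rw [ae_ball_iff hDc]
    intro q _
    rw [ae_iff]
    simp only [not_not]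
    refine null_tail P hP _ fun x hx => ?_
    refine measure_mono_null (t := {z | ψ z ≤ q} \ Iic x) ?_ ?_
    · rintro z ⟨hz, hzx⟩
      exact ⟨hz.1, by simpa using hzx⟩
    · have hsub : Iic x ⊆ {z | ψ z ≤ q} := fun z hz => (hψ hz).trans hx.1
      rw [measure_sdiff hsub measurableSet_Iic.nullMeasurableSet (measure_ne_top _ _)]
      exact tsub_eq_zero_of_le hx.2
  filter_upwards [key] with x hx
  apply le_antisymm
  · by_contra hlt
    push Not at hlt
    obtain ⟨q, hqD, hq1, hq2⟩ := hDd.exists_between hlt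
    refine hx q hqD ⟨hq1.le, ?_⟩
    by_contra hc
    push Not at hc
    refine absurd hq2 (not_lt.2 (sInf_le ?_))
    change cdf P x < cdf _ q
    have : IsProbabilityMeasure (Measure.map ψ P) := Measure.isProbabilityMeasure_map hm.aemeasurable
    rw [cdf_lt_cdf_iff, hap]
    exact hc
  · refine le_sInf fun y hy => ?_
    have : IsProbabilityMeasure (Measure.map ψ P) := Measure.isProbabilityMeasure_map hm.aemeasurable
    change cdf P x < cdf _ y at hy
    rw [cdf_lt_cdf_iff, hap] at hy
    by_contra hc
    refine absurd hy (not_lt.2 (measure_mono fun z hz => ?_))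
    by_contra hzx
    exact hc ((hψ (le_of_lt (by simpa using hzx))).trans hz)

lemma starTransform_recover (μ₀ : Measure EReal) [IsFiniteMeasure μ₀]
    (hμ₀ : μ₀ ≠ 0) (hatoms : ∀ x : EReal, μ₀ {x} = 0) (f : EReal → EReal) (hf : Measurable f)
    (hfm : ∃ ψ : EReal → EReal, Monotone ψ ∧ f =ᵐ[μ₀] ψ) (r : ℝ≥0) (hr : 0 < r) :
    starTransform μ₀ (r • Measure.map f (normalized μ₀)) =ᵐ[μ₀] f := by
  obtain ⟨ψ, hψ, hfψ⟩ := hfm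
  have := normalized_prob μ₀ hμ₀
  have hae := ae_normalized μ₀ hμ₀
  have hfψ' : f =ᵐ[normalized μ₀] ψ := by rw [Filter.EventuallyEq, hae]; exact hfψ
  have h1 : IsProbabilityMeasure (Measure.map f (normalized μ₀)) :=
    Measure.isProbabilityMeasure_map hf.aemeasurable
  rw [starTransform, normalized_smul_prob _ r hr, Measure.map_congr hfψ']
  have hd := dagger_recover (normalized μ₀) (fun x => by simp [normalized, hatoms]) ψ hψ
  rw [Filter.EventuallyEq, hae] at hd
  exact Filter.EventuallyEq.trans hd hfψ.symm

lemma measure_Iic_continuous (P : Measure EReal) [IsFiniteMeasure P] (hP : ∀ x, P {x} = 0) :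
    Continuous fun x => P (Iic x) := by
  rw [continuous_iff_continuousAt]
  intro a
  refine tendsto_measure_of_ae_tendsto_indicator_of_isFiniteMeasure (nhds a) measurableSet_Iic
    (fun _ => measurableSet_Iic) ?_
  have : ∀ᵐ z ∂P, z ≠ a := by simp [ae_iff, hP]
  filter_upwards [this] with z hz
  rcases hz.lt_or_gt with h | h
  · filter_upwards [Ioi_mem_nhds h] with x hx
    have hx' : z < x := hx
    simp [h.le, hx'.le]
  · filter_upwards [Iio_mem_nhds h] with x hx
    have hx' : x < z := hx
    simp [h.not_ge, hx'.not_ge]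

lemma measure_Iic_right (P : Measure EReal) [IsFiniteMeasure P] (a : EReal) :
    Filter.Tendsto (fun x => P (Iic x)) (nhdsWithin a (Ioi a)) (nhds (P (Iic a))) := by
  refine tendsto_measure_of_ae_tendsto_indicator_of_isFiniteMeasure _ measurableSet_Iic
    (fun _ => measurableSet_Iic) ?_
  refine Filter.Eventually.of_forall fun z => ?_
  rcases le_or_gt z a with h | h
  · filter_upwards [self_mem_nhdsWithin] with x hx
    simp [h, h.trans (le_of_lt hx)]
  · filter_upwards [mem_nhdsWithin_of_mem_nhds (Iio_mem_nhds h)] with x hx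
    have hx' : x < z := hx
    simp [h.not_ge, hx'.not_ge]

lemma le_of_dagger_le (P N : Measure EReal) [IsProbabilityMeasure P] [IsProbabilityMeasure N]
    (x y : EReal) (h : dagger (cdf N) (cdf P x) ≤ y) : P (Iic x) ≤ N (Iic y) := by
  by_contra hc
  push Not at hc
  have hy : y ≠ ⊤ := by
    rintro rfl
    rw [Iic_top, measure_univ] at hc
    exact absurd hc (not_lt.2 prob_le_one)
  have hev := (measure_Iic_right N y).eventually (Iio_mem_nhds hc)
  have hne : (nhdsWithin y (Ioi y)).NeBot := nhdsGT_neBot_of_exists_gt ⟨⊤, lt_top_iff_ne_top.2 hy⟩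
  obtain ⟨z, hz1, hz2⟩ := (hev.and self_mem_nhdsWithin).exists
  obtain ⟨w, hw, hwz⟩ := sInf_lt_iff.1 (lt_of_le_of_lt h hz2)
  change cdf P x < cdf N w at hw
  rw [cdf_lt_cdf_iff] at hw
  exact absurd (hw.trans_le (measure_mono (Iic_subset_Iic.2 hwz.le))) (not_lt.2 (le_of_lt hz1))

lemma cdf_le_of_dagger (P N₁ N₂ : Measure EReal) [IsProbabilityMeasure P]
    [IsProbabilityMeasure N₁] [IsProbabilityMeasure N₂] (hP : ∀ x, P {x} = 0)
    (h : dagger (cdf N₁) ∘ cdf P =ᵐ[P] dagger (cdf N₂) ∘ cdf P) (y : EReal) :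
    N₂ (Iic y) ≤ N₁ (Iic y) := by
  by_contra hc
  push Not at hc
  obtain ⟨b, hb1, hb2⟩ := exists_between hc
  obtain ⟨a, ha1, ha2⟩ := exists_between hb1
  have hsurj : ∀ c < N₂ (Iic y), ∃ x, P (Iic x) = c := by
    intro c hcl
    have := intermediate_value_Icc (bot_le (a := (⊤ : EReal)))
      (measure_Iic_continuous P hP).continuousOn
    have hmem : c ∈ Icc (P (Iic ⊥)) (P (Iic ⊤)) := by
      rw [Iic_bot, hP, Iic_top, measure_univ]
      exact ⟨zero_le, (hcl.trans_le prob_le_one).le⟩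
    obtain ⟨x, -, hx⟩ := this hmem
    exact ⟨x, hx⟩
  obtain ⟨x₁, hx₁⟩ := hsurj a (ha2.trans hb2)
  obtain ⟨x₂, hx₂⟩ := hsurj b hb2
  have hnull : P (Iic x₂ \ Iic x₁) = 0 := by
    refine measure_mono_null ?_ (ae_iff.1 h)
    rintro x ⟨hxa, hxb⟩ heq
    simp only [mem_Iic, not_le] at hxa hxb
    simp only [Function.comp] at heq
    have h2 : dagger (cdf N₂) (cdf P x) ≤ y := by
      refine sInf_le ?_
      change cdf P x < cdf N₂ y
      rw [cdf_lt_cdf_iff]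
      exact lt_of_le_of_lt (measure_mono (Iic_subset_Iic.2 hxa)) (hx₂ ▸ hb2)
    have h1 := le_of_dagger_le P N₁ x y (heq ▸ h2)
    have h3 : P (Iic x₁) ≤ P (Iic x) := measure_mono (Iic_subset_Iic.2 hxb.le)
    rw [hx₁] at h3
    exact absurd (h3.trans h1) (not_le.2 ha1)
  have := measure_mono (μ := P) (show Iic x₂ ⊆ (Iic x₂ \ Iic x₁) ∪ Iic x₁ by
    intro z hz; by_cases h : z ∈ Iic x₁ <;> simp_all)
  have h4 := this.trans (measure_union_le _ _)
  rw [hnull, zero_add, hx₁, hx₂] at h4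
  exact absurd h4 (not_le.2 ha2)

lemma starTransform_inj (μ₀ η₁ η₂ : Measure EReal) [IsFiniteMeasure μ₀] [IsFiniteMeasure η₁]
    [IsFiniteMeasure η₂] (hμ₀ : μ₀ ≠ 0) (hatoms : ∀ x : EReal, μ₀ {x} = 0)
    (h1 : η₁ ≠ 0) (h2 : η₂ ≠ 0) (hu : η₁ univ = η₂ univ)
    (h : starTransform μ₀ η₁ =ᵐ[μ₀] starTransform μ₀ η₂) : η₁ = η₂ := by
  have := normalized_prob μ₀ hμ₀
  have := normalized_prob η₁ h1
  have := normalized_prob η₂ h2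
  have hP : ∀ x, normalized μ₀ {x} = 0 := fun x => by simp [normalized, hatoms]
  rw [Filter.EventuallyEq, ← ae_normalized μ₀ hμ₀] at h
  have hN : normalized η₁ = normalized η₂ := Measure.ext_of_Iic _ _ fun y =>
    le_antisymm (cdf_le_of_dagger _ _ _ hP (Filter.EventuallyEq.symm h) y)
      (cdf_le_of_dagger _ _ _ hP h y)
  rw [← smul_normalized η₁ h1, ← smul_normalized η₂ h2, hN, hu]

theorem scdt_inversion_and_injectivity (μ₀ : Measure EReal) [IsFiniteMeasure μ₀]
    (hμ₀ : μ₀ ≠ 0) (hatoms : ∀ x : EReal, μ₀ {x} = 0)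
    (f g : EReal → EReal) (hf : Measurable f) (hg : Measurable g)
    (hfm : ∃ ψ : EReal → EReal, Monotone ψ ∧ f =ᵐ[μ₀] ψ)
    (hgm : ∃ ψ : EReal → EReal, Monotone ψ ∧ g =ᵐ[μ₀] ψ)
    (r s : ℝ≥0) (hr : 0 < r) (hs : 0 < s)
    (hsing : Measure.map f μ₀ ⟂ₘ Measure.map g μ₀) :
    -- the Jordan decomposition of ν = r·f_#(μ₀/‖μ₀‖) − s·g_#(μ₀/‖μ₀‖)
    ((r • Measure.map f (normalized μ₀)).toSignedMeasure -
        (s • Measure.map g (normalized μ₀)).toSignedMeasure).toJordanDecomposition.posPart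
      = r • Measure.map f (normalized μ₀) ∧
    ((r • Measure.map f (normalized μ₀)).toSignedMeasure -
        (s • Measure.map g (normalized μ₀)).toSignedMeasure).toJordanDecomposition.negPart
      = s • Measure.map g (normalized μ₀) ∧
    -- total masses
    (r • Measure.map f (normalized μ₀)) Set.univ = (r : ℝ≥0∞) ∧
    (s • Measure.map g (normalized μ₀)) Set.univ = (s : ℝ≥0∞) ∧
    -- the transforms recover f and g
    starTransform μ₀ (r • Measure.map f (normalized μ₀)) =ᵐ[μ₀] f ∧
    starTransform μ₀ (s • Measure.map g (normalized μ₀)) =ᵐ[μ₀] g ∧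
    -- injectivity of the SCDT on signed measures with nonzero Jordan parts
    (∀ ν₁ ν₂ : SignedMeasure EReal,
      ν₁.toJordanDecomposition.posPart ≠ 0 → ν₁.toJordanDecomposition.negPart ≠ 0 →
      ν₂.toJordanDecomposition.posPart ≠ 0 → ν₂.toJordanDecomposition.negPart ≠ 0 →
      ν₁.toJordanDecomposition.posPart Set.univ = ν₂.toJordanDecomposition.posPart Set.univ →
      ν₁.toJordanDecomposition.negPart Set.univ = ν₂.toJordanDecomposition.negPart Set.univ →
      starTransform μ₀ ν₁.toJordanDecomposition.posPart
        =ᵐ[μ₀] starTransform μ₀ ν₂.toJordanDecomposition.posPart →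
      starTransform μ₀ ν₁.toJordanDecomposition.negPart
        =ᵐ[μ₀] starTransform μ₀ ν₂.toJordanDecomposition.negPart →
      ν₁ = ν₂) := by
  have hprob := normalized_prob μ₀ hμ₀
  have hpf : IsProbabilityMeasure (Measure.map f (normalized μ₀)) :=
    Measure.isProbabilityMeasure_map hf.aemeasurable
  have hpg : IsProbabilityMeasure (Measure.map g (normalized μ₀)) :=
    Measure.isProbabilityMeasure_map hg.aemeasurable
  have hs' : (r • Measure.map f (normalized μ₀)) ⟂ₘ (s • Measure.map g (normalized μ₀)) := by
    refine Measure.MutuallySingular.smul_nnreal _ ?_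
    refine (Measure.MutuallySingular.smul_nnreal _ ?_).symm
    rw [normalized, Measure.map_smul, Measure.map_smul]
    refine Measure.MutuallySingular.smul_nnreal _ ?_
    exact (Measure.MutuallySingular.smul_nnreal _ hsing).symm
  have hj : ((r • Measure.map f (normalized μ₀)).toSignedMeasure -
      (s • Measure.map g (normalized μ₀)).toSignedMeasure).toJordanDecomposition =
      ⟨r • Measure.map f (normalized μ₀), s • Measure.map g (normalized μ₀), hs'⟩ :=
    SignedMeasure.toJordanDecomposition_eq rfl
  refine ⟨by rw [hj], by rw [hj], ?_, ?_, starTransform_recover μ₀ hμ₀ hatoms f hf hfm r hr,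
    starTransform_recover μ₀ hμ₀ hatoms g hg hgm s hs, ?_⟩
  · rw [nnsmul_app, measure_univ, mul_one]
  · rw [nnsmul_app, measure_univ, mul_one]
  · intro ν₁ ν₂ hp1 hn1 hp2 hn2 hpu hnu hp hn
    rw [← ν₁.toSignedMeasure_toJordanDecomposition, ← ν₂.toSignedMeasure_toJordanDecomposition]
    congr 1
    exact JordanDecomposition.ext (starTransform_inj μ₀ _ _ hμ₀ hatoms hp1 hp2 hpu hp)
      (starTransform_inj μ₀ _ _ hμ₀ hatoms hn1 hn2 hnu hn)
end

section
/- Hahn decomposition under monotone pullback: let ν and η be finite signed Borel measures on EReal such that F_η(x) = F_ν(g(x)) for all x, where g : EReal → EReal is a strictly increasing measurable bijection and F_η(x) = η([−∞, x]). If (Ω⁺, Ω⁻) is a Hahn decomposition of EReal for ν, then (g⁻¹(Ω⁺), g⁻¹(Ω⁻)) is a Hahn decomposition for η; consequently the Jordan parts satisfy F_{η⁺}(x) = F_{ν⁺}(g(x)) and F_{η⁻}(x) = F_{ν⁻}(g(x)) for all x ∈ EReal, and in particular ‖η⁺‖ = ‖ν⁺‖ and ‖η⁻‖ = ‖ν⁻‖.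 -/
open MeasureTheory Set
open scoped ENNReal

theorem hahn_decomposition_monotone_pullback (ν η : SignedMeasure EReal)
    (g : EReal → EReal) (hgmono : StrictMono g) (hgbij : Function.Bijective g)
    (hgmeas : Measurable g)
    (hF : ∀ x : EReal, η (Set.Iic x) = ν (Set.Iic (g x)))
    (Ωp Ωn : Set EReal) (hΩp : MeasurableSet Ωp) (hΩn : MeasurableSet Ωn)
    (hunion : Ωp ∪ Ωn = Set.univ) (hdisj : Disjoint Ωp Ωn)
    (hpos : (0 : SignedMeasure EReal).restrict Ωp ≤ ν.restrict Ωp)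
    (hneg : ν.restrict Ωn ≤ (0 : SignedMeasure EReal).restrict Ωn) :
    -- (g⁻¹(Ω⁺), g⁻¹(Ω⁻)) is a Hahn decomposition for η
    ((0 : SignedMeasure EReal).restrict (g ⁻¹' Ωp) ≤ η.restrict (g ⁻¹' Ωp)) ∧
    (η.restrict (g ⁻¹' Ωn) ≤ (0 : SignedMeasure EReal).restrict (g ⁻¹' Ωn)) ∧
    -- the Jordan parts satisfy the same composition relation on cumulations
    (∀ x : EReal, η.toJordanDecomposition.posPart (Set.Iic x)
        = ν.toJordanDecomposition.posPart (Set.Iic (g x))) ∧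
    (∀ x : EReal, η.toJordanDecomposition.negPart (Set.Iic x)
        = ν.toJordanDecomposition.negPart (Set.Iic (g x))) ∧
    -- in particular equal total masses
    η.toJordanDecomposition.posPart Set.univ = ν.toJordanDecomposition.posPart Set.univ ∧
    η.toJordanDecomposition.negPart Set.univ = ν.toJordanDecomposition.negPart Set.univ := by
  let e : EReal ≃o EReal := hgmono.orderIsoOfSurjective g hgbij.2
  have hes : ∀ x, g (e.symm x) = x := fun x => e.apply_symm_apply x
  have hse : ∀ x, e.symm (g x) = x := fun x => e.symm_apply_apply x
  have hme : Measurable e.symm := e.symm.monotone.measurable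
  have hmap : η.map g = ν := by
    refine VectorMeasure.ext_of_generateFrom (range Iic) ?_
      (BorelSpace.measurable_eq.trans (borel_eq_generateFrom_Iic EReal)) isPiSystem_Iic ?_
    rotate_left
    · rw [VectorMeasure.map_apply _ hgmeas MeasurableSet.univ]
      have h := hF ⊤
      have hg : g ⊤ = ⊤ := e.map_top
      rw [hg] at h
      simpa using h
    · rintro _ ⟨x, rfl⟩
      rw [VectorMeasure.map_apply _ hgmeas measurableSet_Iic]
      have h1 : g ⁻¹' Iic x = Iic (e.symm x) := by
        ext y
        simp only [mem_preimage, mem_Iic]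
        rw [← hgmono.le_iff_le (a := y) (b := e.symm x), hes]
      rw [h1, hF, hes]
  have hη : ∀ s, MeasurableSet s → η s = ν (e.symm ⁻¹' s) := by
    intro s hs
    rw [← hmap, VectorMeasure.map_apply _ hgmeas (hme hs), ← preimage_comp]
    congr 1
    ext y
    simp [hse]
  let j : JordanDecomposition EReal :=
    { posPart := ν.toJordanDecomposition.posPart.map e.symm
      negPart := ν.toJordanDecomposition.negPart.map e.symm
      posPart_finite := inferInstance
      negPart_finite := inferInstance
      mutuallySingular := by
        obtain ⟨s, hs, h1, h2⟩ := ν.toJordanDecomposition.mutuallySingular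
        refine ⟨g ⁻¹' s, hgmeas hs, ?_, ?_⟩
        · rw [Measure.map_apply hme (hgmeas hs), ← preimage_comp]
          convert h1 using 2
          ext y
          simp [hes]
        · rw [Measure.map_apply hme (hgmeas hs).compl, ← preimage_compl, ← preimage_comp]
          convert h2 using 2
          ext y
          simp [hes] }
  have hj : η.toJordanDecomposition = j := by
    apply SignedMeasure.toJordanDecomposition_eq
    ext s hs
    rw [hη s hs, ν.apply_eq_posPart_real_sub_negPart_real (hme hs),
      JordanDecomposition.toSignedMeasure, Measure.toSignedMeasure_sub_apply hs,
      map_measureReal_apply hme hs, map_measureReal_apply hme hs]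
  have hpre : ∀ x, e.symm ⁻¹' Iic x = Iic (g x) := by
    intro x
    ext y
    simp only [mem_preimage, mem_Iic]
    rw [← hgmono.le_iff_le, hes]
  refine ⟨?_, ?_, fun x => ?_, fun x => ?_, ?_, ?_⟩
  · rw [VectorMeasure.restrict_le_restrict_iff _ _ (hgmeas hΩp)]
    intro s hs hsub
    rw [hη s hs]
    refine (VectorMeasure.restrict_le_restrict_iff _ _ hΩp).1 hpos (hme hs) ?_
    intro y hy
    have := hsub hy
    rwa [mem_preimage, hes] at this
  · rw [VectorMeasure.restrict_le_restrict_iff _ _ (hgmeas hΩn)]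
    intro s hs hsub
    rw [hη s hs]
    refine (VectorMeasure.restrict_le_restrict_iff _ _ hΩn).1 hneg (hme hs) ?_
    intro y hy
    have := hsub hy
    rwa [mem_preimage, hes] at this
  · rw [hj, Measure.map_apply hme measurableSet_Iic, hpre]
  · rw [hj, Measure.map_apply hme measurableSet_Iic, hpre]
  · rw [hj, Measure.map_apply hme MeasurableSet.univ, preimage_univ]
  · rw [hj, Measure.map_apply hme MeasurableSet.univ, preimage_univ]
end

section
/- Composition property of the CDT: let μ₀ be a Borel probability measure on EReal that gives no mass to atoms, let ν be a Borel probability measure on EReal, let g : EReal → EReal be a strictly increasing measurable surjection, and let η be the probability measure determined by F_η(x) = F_ν(g(x)) for all x ∈ EReal. Then the transform of η with respect to μ₀ satisfies F_η† ∘ F_{μ₀} = g† ∘ (F_ν† ∘ F_{μ₀}) μ₀-almost everywhere, where g† is the monotone generalized inverse of g. -/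
open MeasureTheory Set
open scoped ENNReal

theorem cdt_composition_property (μ₀ ν η : Measure EReal)
    [IsProbabilityMeasure μ₀] [IsProbabilityMeasure ν] [IsProbabilityMeasure η]
    (hatoms : ∀ x : EReal, μ₀ {x} = 0)
    (g : EReal → EReal) (hgmono : StrictMono g) (hgsurj : Function.Surjective g)
    (hgmeas : Measurable g)
    (hcomp : ∀ x : EReal, cdf η x = cdf ν (g x)) :
    cdt μ₀ η =ᵐ[μ₀] dagger g ∘ cdt μ₀ ν := by
  let e : EReal ≃o EReal := hgmono.orderIsoOfSurjective g hgsurj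
  have he : ∀ x, e x = g x := fun x => rfl
  have hdag : ∀ y, dagger g y = e.symm y := by
    intro y
    have hset : {x : EReal | g x > y} = Set.Ioi (e.symm y) := by
      ext x
      simp only [Set.mem_ofPred_eq, Set.mem_Ioi, gt_iff_lt, ← he]
      exact (e.symm_apply_lt).symm
    unfold dagger
    rw [hset]
    exact le_antisymm (le_of_forall_gt_imp_ge_of_dense fun a ha => sInf_le ha)
      (le_sInf fun a ha => le_of_lt ha)
  refine Filter.Eventually.of_forall fun t => ?_
  simp only [cdt, Function.comp_apply]
  rw [hdag]
  unfold dagger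
  rw [e.symm.map_sInf_eq_sInf_symm_preimage]
  congr 1
  ext x
  simp [hcomp, he]
end

section
/- Translation property of the CDT: let μ₀ be a Borel probability measure on EReal that gives no mass to atoms, let ν be a Borel probability measure on EReal, let a ∈ ℝ, and let η be the probability measure determined by F_η(x) = F_ν(x − a) for all x ∈ EReal (with EReal subtraction of the real constant a). Then the transform of η satisfies F_η† ∘ F_{μ₀} = (F_ν† ∘ F_{μ₀}) + a μ₀-almost everywhere. -/
open MeasureTheory Set
open scoped ENNReal

theorem cdt_translation_property (μ₀ ν η : Measure EReal)
    [IsProbabilityMeasure μ₀] [IsProbabilityMeasure ν] [IsProbabilityMeasure η]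
    (hatoms : ∀ x : EReal, μ₀ {x} = 0)
    (a : ℝ)
    (htrans : ∀ x : EReal, cdf η x = cdf ν (x - (a : EReal))) :
    cdt μ₀ η =ᵐ[μ₀] fun x => cdt μ₀ ν x + (a : EReal) := by
  refine Filter.Eventually.of_forall fun t => ?_
  have key : ∀ x : EReal, x - (a : EReal) + (a : EReal) = x := by
    intro x
    induction x with
    | bot => simp
    | top => simp
    | coe r => norm_cast; ring
  have key2 : ∀ x : EReal, x + (a : EReal) - (a : EReal) = x := by
    intro x
    induction x with
    | bot => simp
    | top => simp
    | coe r => norm_cast; ring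
  simp only [cdt, dagger, Function.comp_apply, htrans]
  apply le_antisymm
  · rw [← key (sInf _)]
    refine add_le_add (le_sInf fun x hx => ?_) le_rfl
    have h : sInf {x : EReal | cdf ν (x - (a : EReal)) > cdf μ₀ t} ≤ x + (a : EReal) := by
      apply sInf_le
      simpa only [mem_setOf_eq, key2] using hx
    have h2 := EReal.sub_le_sub h (le_refl (a : EReal))
    rwa [key2] at h2
  · refine le_sInf fun x hx => ?_
    rw [← key x]
    exact add_le_add (sInf_le hx) le_rfl
end
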